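/- Let p be an odd prime and k∈ℕ with gcd(k,p-1)=1 or (gcd(k,p-1)=2 and p≡3 mod 4). Let K be a number field with K∩ℚ(ζ_p)=ℚ, and let f:ℤ→K be an odd p-periodic function with D_k(1,f)=0. Then f is identically zero. -/

import Mathlib

open scoped Real

noncomputable def xk (k p : ℕ) [NeZero p] (r : ZMod p) : ℝ :=
  ((p : ℝ))⁻¹ ^ k *
    ∑ m ∈ Finset.univ.filter (fun m : Fin k → (ZMod p)ˣ => ∏ i, ((m i : ZMod p)) = r),
      ∏ i, Real.cot (π * ((m i : ZMod p).val : ℝ) / p)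

/-- The `k`-fold divisor function. -/
def dk (k n : ℕ) : ℕ :=
  ((Fintype.piFinset fun _ : Fin k => Finset.range (n + 1)).filter
    (fun f => ∏ i, f i = n)).card

open Filter Topology

lemma dk_zero {n : ℕ} : dk 0 n = if n = 1 then 1 else 0 := by
  unfold dk
  split_ifs with h
  · subst h; simp
  · simp [Ne.symm h]

lemma mem_dk_set {k n : ℕ} (hn : n ≠ 0) (f : Fin k → ℕ) :
    f ∈ ((Fintype.piFinset fun _ : Fin k => Finset.range (n + 1)).filter
    (fun f => ∏ i, f i = n)) ↔ ∏ i, f i = n := by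
  simp only [Finset.mem_filter, Fintype.mem_piFinset, Finset.mem_range, and_iff_right_iff_imp]
  intro h i
  have : f i ∣ n := h ▸ Finset.dvd_prod_of_mem f (Finset.mem_univ i)
  exact Nat.lt_succ_of_le (Nat.le_of_dvd (Nat.pos_of_ne_zero hn) this)

lemma dk_succ {k n : ℕ} (hn : n ≠ 0) :
    dk (k + 1) n = ∑ x ∈ n.divisorsAntidiagonal, dk k x.2 := by
  unfold dk
  rw [← Finset.card_sigma]
  refine Finset.card_nbij' (fun f => ⟨(f 0, ∏ i, Fin.tail f i), Fin.tail f⟩)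
    (fun y => Fin.cons y.1.1 y.2) ?_ ?_ ?_ ?_
  · intro f hf
    rw [Finset.mem_coe, mem_dk_set hn, Fin.prod_univ_succ] at hf
    have h2 : ∏ i, Fin.tail f i ≠ 0 := by
      intro h
      apply hn
      rw [← hf]
      simp only [Fin.tail] at h
      rw [h, mul_zero]
    rw [Finset.mem_coe, Finset.mem_sigma]
    refine ⟨Nat.mem_divisorsAntidiagonal.mpr ⟨hf, hn⟩, ?_⟩
    rw [mem_dk_set h2]
  · rintro ⟨⟨a, b⟩, f⟩ hf
    rw [Finset.mem_coe, Finset.mem_sigma] at hf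
    obtain ⟨h1, h2⟩ := hf
    rw [Nat.mem_divisorsAntidiagonal] at h1
    have hb : b ≠ 0 := by rintro rfl; simp at h1; exact hn h1.1.symm
    rw [mem_dk_set hb] at h2
    rw [Finset.mem_coe, mem_dk_set hn, Fin.prod_univ_succ]
    simp [h2, h1.1]
  · intro f hf
    simp
  · rintro ⟨⟨a, b⟩, f⟩ hf
    rw [Finset.mem_coe, Finset.mem_sigma] at hf
    obtain ⟨h1, h2⟩ := hf
    rw [Nat.mem_divisorsAntidiagonal] at h1
    have hb : b ≠ 0 := by rintro rfl; simp at h1; exact hn h1.1.symm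
    rw [mem_dk_set hb] at h2
    simp only at h2
    subst h2
    simp

lemma LSeries_dk {N : ℕ} (χ : DirichletCharacter ℂ N) {s : ℂ} (hs : 1 < s.re) (k : ℕ) :
    LSeriesHasSum (fun n => (dk k n : ℂ) * χ n) s (LSeries (fun n => χ n) s ^ k) := by
  have h0 : LSeriesHasSum (fun n : ℕ => χ n) s (LSeries (fun n => χ n) s) :=
    (DirichletCharacter.LSeriesSummable_of_one_lt_re χ hs).LSeriesHasSum
  induction k with
  | zero =>
    rw [pow_zero]
    have : LSeriesHasSum LSeries.delta s 1 := by
      have h := (hasSum_ite_eq (1:ℕ) (1:ℂ))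
      refine h.congr_fun ?_
      intro n
      rw [LSeries.term_delta]
    refine (LSeriesHasSum_congr _ _ (fun {n} hn => ?_)).mp this
    rw [dk_zero, LSeries.delta]
    split_ifs with h
    · subst h; simp
    · simp
  | succ k ih =>
    rw [pow_succ']
    refine (LSeriesHasSum_congr _ _ (fun {n} hn => ?_)).mp (h0.convolution ih)
    rw [LSeries.convolution_def, dk_succ hn]
    push_cast
    rw [Finset.sum_mul]
    refine Finset.sum_congr rfl fun x hx => ?_
    obtain ⟨h1, -⟩ := Nat.mem_divisorsAntidiagonal.mp hx
    rw [← h1]; push_cast; rw [map_mul]; ring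
lemma rpow_bound_aux {u v s : ℝ} (hu : 1 ≤ u) (huv : u ≤ v) (h1 : v - u ≤ 1)
    (hs1 : 1 ≤ s) (hs2 : s ≤ 2) : |1 / u ^ s - 1 / v ^ s| ≤ 2 / (u * v) := by
  have hu0 : 0 < u := by linarith
  have hv0 : 0 < v := by linarith
  have hus : 0 < u ^ s := by positivity
  have hvs : 0 < v ^ s := by positivity
  have h0 : u ^ s ≤ v ^ s := by gcongr
  have key : 1 / u ^ s - 1 / v ^ s = (1 / u ^ s) * (1 - (u / v) ^ s) := by
    rw [Real.div_rpow hu0.le hv0.le]; field_simp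
  rw [abs_of_nonneg (by rw [sub_nonneg]; gcongr), key]
  have ht : 0 < u / v := by positivity
  have ht1 : u / v ≤ 1 := by rw [div_le_one hv0]; exact huv
  have h2 : (u / v) ^ (2:ℝ) ≤ (u / v) ^ s := Real.rpow_le_rpow_of_exponent_ge ht ht1 hs2
  rw [Real.rpow_two] at h2
  have h3 : 1 / u ^ s ≤ 1 / u := by
    have : u ^ (1:ℝ) ≤ u ^ s := Real.rpow_le_rpow_of_exponent_le hu hs1
    rw [Real.rpow_one] at this
    gcongr
  have h4 : 1 - (u / v) ^ s ≤ 2 * (1 - u / v) := by nlinarith [sq_nonneg (1 - u/v)]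
  have h5 : 0 ≤ 1 - (u / v) ^ s := by
    have := Real.rpow_le_one ht.le ht1 (by linarith : 0 ≤ s); linarith
  calc 1 / u ^ s * (1 - (u / v) ^ s) ≤ 1 / u * (2 * (1 - u / v)) := by gcongr
    _ = 2 * (v - u) / (u * v) := by field_simp
    _ ≤ 2 / (u * v) := by gcongr; linarith

lemma rpow_bound {u v s : ℝ} (hu : 1 ≤ u) (hv : 1 ≤ v) (h1 : |v - u| ≤ 1)
    (hs1 : 1 ≤ s) (hs2 : s ≤ 2) : |1 / u ^ s - 1 / v ^ s| ≤ 2 / (u * v) := by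
  have := abs_le.mp h1
  rcases le_total u v with h | h
  · exact rpow_bound_aux hu h (by linarith) hs1 hs2
  · rw [abs_sub_comm, mul_comm]; exact rpow_bound_aux hv h (by linarith) hs1 hs2

lemma hurwitzOdd_tsum {x : ℝ} (hx0 : 0 < x) (hx1 : x < 1) :
    HasSum (fun n : ℕ => ((1 / (n + x) - 1 / (n + 1 - x)) / 2 : ℝ))
      (HurwitzZeta.hurwitzZetaOdd (x : UnitAddCircle) 1).re := by
  set T : ℝ → ℕ → ℝ := fun s n => (1 / ((n:ℝ) + x) ^ s - 1 / ((n:ℝ) + 1 - x) ^ s) / 2 with hT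
  have hpos1 : ∀ n : ℕ, 0 < (n:ℝ) + x := fun n => by positivity
  have hpos2 : ∀ n : ℕ, 0 < (n:ℝ) + 1 - x := fun n => by
    have : (0:ℝ) ≤ n := Nat.cast_nonneg n
    linarith
  have hsum : ∀ s : ℝ, 1 < s → ∑' n, T s n =
      (HurwitzZeta.hurwitzZetaOdd (x : UnitAddCircle) s).re := by
    intro s hs
    have h := HurwitzZeta.hasSum_nat_hurwitzZetaOdd_of_mem_Icc (a := x) ⟨hx0.le, hx1.le⟩
      (s := (s:ℂ)) (by simpa using hs)
    have h' := Complex.hasSum_re h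
    rw [← h'.tsum_eq]
    refine tsum_congr fun n => ?_
    have : ((1 / ((n:ℂ) + x) ^ (s:ℂ) - 1 / ((n:ℂ) + 1 - x) ^ (s:ℂ)) / 2 : ℂ) = ((T s n : ℝ) : ℂ) := by
      simp only [hT]
      push_cast
      rw [Complex.ofReal_cpow (hpos1 n).le, Complex.ofReal_cpow (hpos2 n).le]
      push_cast
      rfl
    rw [this, Complex.ofReal_re]
  set C : ℝ := |1 / x| + |1 / x ^ (2:ℝ)| + |1 / (1 - x)| + |1 / (1 - x) ^ (2:ℝ)| with hC
  set bd : ℕ → ℝ := fun n => if n = 0 then C else 1 / (n:ℝ) ^ 2 with hbd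
  have hbs : Summable bd := by
    have h1 : Summable (fun n : ℕ => 1 / (n:ℝ) ^ 2) := Real.summable_one_div_nat_pow.mpr (by norm_num)
    rw [← summable_nat_add_iff 1] at h1 ⊢
    refine h1.congr fun n => ?_
    simp [hbd]
  have hle : ∀ s : ℝ, 1 ≤ s → s ≤ 2 → ∀ n, ‖T s n‖ ≤ bd n := by
    intro s hs1 hs2 n
    rcases Nat.eq_zero_or_pos n with rfl | hn
    · have aux : ∀ y : ℝ, 0 < y → y < 1 → |1 / y ^ s| ≤ |1 / y ^ (2:ℝ)| := by
        intro y hy hy1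
        have : y ^ (2:ℝ) ≤ y ^ s := Real.rpow_le_rpow_of_exponent_ge hy hy1.le hs2
        rw [abs_of_nonneg (by positivity), abs_of_nonneg (by positivity)]
        gcongr
      have a1 := aux x hx0 hx1
      have a2 := aux (1 - x) (by linarith) (by linarith)
      simp only [hT, hbd, Nat.cast_zero, zero_add, if_true, Real.norm_eq_abs]
      rw [abs_div, abs_two]
      have := abs_sub (1 / x ^ s) (1 / (1 - x) ^ s)
      have b1 := abs_nonneg (1 / x)
      have b2 := abs_nonneg (1 / (1 - x))
      have b3 := abs_nonneg (1 / x ^ s)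
      have b4 := abs_nonneg (1 / (1 - x) ^ s)
      rw [hC]; linarith
    · have hn1 : (1:ℝ) ≤ n := by exact_mod_cast hn
      simp only [hT, hbd, hn.ne', if_false, Real.norm_eq_abs]
      rw [abs_div, abs_two]
      have := rpow_bound (u := n + x) (v := n + 1 - x) (s := s) (by linarith) (by linarith)
        (by rw [abs_le]; constructor <;> linarith) hs1 hs2
      calc _ ≤ 2 / ((n + x) * (n + 1 - x)) / 2 := by gcongr
        _ = 1 / ((n + x) * (n + 1 - x)) := by field_simp
        _ ≤ 1 / ((n:ℝ) ^ 2) := by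
          rw [pow_two]; gcongr <;> linarith
  have hlim : Tendsto (fun s => ∑' n, T s n) (𝓝[>] 1) (𝓝 (∑' n, T 1 n)) := by
    refine tendsto_tsum_of_dominated_convergence hbs ?_ ?_
    · intro n
      have : ContinuousAt (fun s => T s n) 1 := by
        simp only [hT]
        have e1 := (hpos1 n).ne'
        have e2 := (hpos2 n).ne'
        refine ContinuousAt.div_const (ContinuousAt.sub ?_ ?_) _
        · exact continuousAt_const.div (Real.continuousAt_const_rpow e1)
            (Real.rpow_pos_of_pos (hpos1 n) _).ne'
        · exact continuousAt_const.div (Real.continuousAt_const_rpow e2)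
            (Real.rpow_pos_of_pos (hpos2 n) _).ne'
      exact this.tendsto.mono_left nhdsWithin_le_nhds
    · have : Set.Ioo (1:ℝ) 2 ∈ 𝓝[>] (1:ℝ) := Ioo_mem_nhdsGT (by norm_num)
      filter_upwards [this] with s hs n
      exact hle s hs.1.le hs.2.le n
  have hlim2 : Tendsto (fun s : ℝ => ∑' n, T s n) (𝓝[>] 1)
      (𝓝 (HurwitzZeta.hurwitzZetaOdd (x : UnitAddCircle) 1).re) := by
    have hc : Continuous (fun s : ℝ => (HurwitzZeta.hurwitzZetaOdd (x : UnitAddCircle) s).re) :=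
      Complex.continuous_re.comp
        ((HurwitzZeta.differentiable_hurwitzZetaOdd _).continuous.comp Complex.continuous_ofReal)
    have h := (hc.tendsto 1).mono_left (nhdsWithin_le_nhds (s := Set.Ioi 1))
    rw [Complex.ofReal_one] at h
    refine h.congr' ?_
    filter_upwards [self_mem_nhdsWithin] with s hs
    exact (hsum s hs).symm
  have heq := tendsto_nhds_unique hlim hlim2
  rw [← heq]
  have hs1 : Summable (T 1) := Summable.of_norm_bounded hbs (hle 1 le_rfl (by norm_num))
  have := hs1.hasSum
  simpa [hT] using this

lemma hurwitzOdd_im {x : ℝ} (hx0 : 0 < x) (hx1 : x < 1) :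
    (HurwitzZeta.hurwitzZetaOdd (x : UnitAddCircle) 1).im = 0 := by
  have hpos1 : ∀ n : ℕ, 0 < (n:ℝ) + x := fun n => by positivity
  have hpos2 : ∀ n : ℕ, 0 < (n:ℝ) + 1 - x := fun n => by
    have : (0:ℝ) ≤ n := Nat.cast_nonneg n
    linarith
  have hsum : ∀ s : ℝ, 1 < s →
      (HurwitzZeta.hurwitzZetaOdd (x : UnitAddCircle) s).im = 0 := by
    intro s hs
    have h := HurwitzZeta.hasSum_nat_hurwitzZetaOdd_of_mem_Icc (a := x) ⟨hx0.le, hx1.le⟩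
      (s := (s:ℂ)) (by simpa using hs)
    have h' := Complex.hasSum_im h
    rw [← h'.tsum_eq]
    convert tsum_zero with n
    have : ((1 / ((n:ℂ) + x) ^ (s:ℂ) - 1 / ((n:ℂ) + 1 - x) ^ (s:ℂ)) / 2 : ℂ) =
        (((1 / ((n:ℝ) + x) ^ s - 1 / ((n:ℝ) + 1 - x) ^ s) / 2 : ℝ) : ℂ) := by
      push_cast
      rw [Complex.ofReal_cpow (hpos1 n).le, Complex.ofReal_cpow (hpos2 n).le]
      push_cast
      rfl
    rw [this, Complex.ofReal_im]
  have hc : Continuous (fun s : ℝ => (HurwitzZeta.hurwitzZetaOdd (x : UnitAddCircle) s).im) :=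
      Complex.continuous_im.comp
        ((HurwitzZeta.differentiable_hurwitzZetaOdd _).continuous.comp Complex.continuous_ofReal)
  have h := (hc.tendsto 1).mono_left (nhdsWithin_le_nhds (s := Set.Ioi 1))
  rw [Complex.ofReal_one] at h
  refine tendsto_nhds_unique h (tendsto_const_nhds.congr' ?_)
  filter_upwards [self_mem_nhdsWithin] with s hs
  exact (hsum s hs).symm

lemma hurwitzOdd_one {x : ℝ} (hx0 : 0 < x) (hx1 : x < 1) :
    HurwitzZeta.hurwitzZetaOdd (x : UnitAddCircle) 1 = π / 2 * Complex.cot (π * x) := by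
  have h1 := hurwitzOdd_tsum hx0 hx1
  have h2 : HasSum (fun n : ℕ => ((1 / (n + x) - 1 / (n + 1 - x)) / 2 : ℂ))
      (HurwitzZeta.hurwitzZetaOdd (x : UnitAddCircle) 1) := by
    have h := Complex.hasSum_ofReal.mpr h1
    have e : ((HurwitzZeta.hurwitzZetaOdd (x : UnitAddCircle) 1).re : ℂ) =
        HurwitzZeta.hurwitzZetaOdd (x : UnitAddCircle) 1 := by
      apply Complex.ext <;> simp [hurwitzOdd_im hx0 hx1]
    rw [e] at h
    convert h using 2 with n
    push_cast; rfl
  have hxZ : (x : ℂ) ∈ Complex.integerComplement := by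
    rintro ⟨m, hm⟩
    have hm' : (m : ℝ) = x := by exact_mod_cast hm
    have : (0:ℝ) < m := by rw [hm']; exact hx0
    have h3 : (m:ℝ) < 1 := by rw [hm']; exact hx1
    have h4 : 0 < m := by exact_mod_cast this
    have h5 : m < 1 := by exact_mod_cast h3
    omega
  have h3 := tendsto_logDeriv_euler_cot_sub hxZ
  have h4 := h2.tendsto_sum_nat
  have h5 : Tendsto (fun N : ℕ => (1 : ℂ) / (x + N)) atTop (𝓝 0) := by
    have := (tendsto_inv_atTop_zero.comp (tendsto_atTop_add_const_left atTop x
      (tendsto_natCast_atTop_atTop (R := ℝ))))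
    have := (Complex.continuous_ofReal.tendsto 0).comp this
    simpa [Function.comp_def] using this
  have ne1 : ∀ n : ℕ, (n : ℂ) + x ≠ 0 := fun n => by
    have : 0 < (n:ℝ) + x := by positivity
    exact_mod_cast this.ne'
  have ne2 : ∀ n : ℕ, (n : ℂ) + 1 - x ≠ 0 := fun n => by
    have : 0 < (n:ℝ) + 1 - x := by
      have : (0:ℝ) ≤ n := Nat.cast_nonneg n
      linarith
    exact_mod_cast this.ne'
  have key : ∀ N : ℕ, ∑ n ∈ Finset.range N, ((1 / (n + x) - 1 / (n + 1 - x)) / 2 : ℂ) =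
      (1 / x + ∑ n ∈ Finset.range N, cotTerm x n - 1 / (x + N)) / 2 := by
    intro N
    induction N with
    | zero => simp
    | succ N ih =>
      rw [Finset.sum_range_succ, Finset.sum_range_succ, ih]
      simp only [cotTerm]
      have e : (1:ℂ) / (x - (N + 1)) = - (1 / (N + 1 - x)) := by
        rw [← neg_sub, div_neg]
      rw [e]
      push_cast
      rw [add_comm (N:ℂ) x]
      ring
  have h6 := (((h3.const_add (1 / (x:ℂ))).sub h5).div_const 2)
  have := tendsto_nhds_unique h4 (h6.congr fun N => (key N).symm)
  rw [this]; ring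
lemma exists_kth_pow (p k : ℕ) (hp : p.Prime) 
    (hgcd : Nat.gcd k (p - 1) = 1 ∨ (Nat.gcd k (p - 1) = 2 ∧ p % 4 = 3)) (b : (ZMod p)ˣ) :
    ∃ a : (ZMod p)ˣ, a ^ k = b ∨ a ^ k = -b := by
  have : Fact p.Prime := ⟨hp⟩
  have hcard : ∀ c : (ZMod p)ˣ, c ^ (p - 1) = 1 := fun c => ZMod.units_pow_card_sub_one_eq_one p c
  have hbez : ∀ c : (ZMod p)ˣ, ∃ a : (ZMod p)ˣ, a ^ k = c ^ (Nat.gcd k (p - 1)) := by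
    intro c
    refine ⟨c ^ (k.gcdA (p - 1)), ?_⟩
    have h := Nat.gcd_eq_gcd_ab k (p - 1)
    rw [← zpow_natCast c, h, zpow_add, zpow_mul c ((p - 1 : ℕ) : ℤ), zpow_natCast c (p - 1), hcard,
      one_zpow, mul_one, mul_comm, zpow_mul, zpow_natCast]
  rcases hgcd with h | ⟨h, h3⟩
  · obtain ⟨a, ha⟩ := hbez b
    exact ⟨a, Or.inl (by rw [ha, h, pow_one])⟩
  · have hsq : ∀ c : (ZMod p)ˣ, c ^ ((p - 1) / 2) = 1 → ∃ a : (ZMod p)ˣ, a ^ k = c := by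
      intro c hc
      obtain ⟨a, ha⟩ := hbez (c ^ (((p - 1) / 2 + 1) / 2))
      refine ⟨a, ?_⟩
      rw [ha, h, ← pow_mul]
      have : ((p - 1) / 2 + 1) / 2 * 2 = (p - 1) / 2 + 1 := by omega
      rw [this, pow_succ, hc, one_mul]
    have h1 : (b ^ ((p - 1) / 2)) ^ 2 = 1 := by
      rw [← pow_mul]
      have : (p - 1) / 2 * 2 = p - 1 := by omega
      rw [this, hcard]
    have h2 : b ^ ((p - 1) / 2) = 1 ∨ b ^ ((p - 1) / 2) = -1 := by
      have h4 : ((b ^ ((p - 1) / 2) : (ZMod p)ˣ) : ZMod p) ^ 2 = 1 := by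
        rw [← Units.val_pow_eq_pow_val, h1, Units.val_one]
      rcases sq_eq_one_iff.mp h4 with h5 | h5
      · left; exact Units.ext h5
      · right; exact Units.ext (by rw [h5]; simp)
    rcases h2 with h2 | h2
    · obtain ⟨a, ha⟩ := hsq b h2
      exact ⟨a, Or.inl ha⟩
    · have hodd : Odd ((p - 1) / 2) := by rw [Nat.odd_iff]; omega
      obtain ⟨a, ha⟩ := hsq (-b) (by rw [hodd.neg_pow, h2, neg_neg])
      exact ⟨a, Or.inr ha⟩

lemma isGalois_adjoin (F : Type*) {E : Type*} [Field F] [Field E] [Algebra F E] {p : ℕ} [NeZero p]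
    (ζ : E) (hζ : IsPrimitiveRoot ζ p) (hIntg : IsIntegral F ζ) :
    IsGalois F (IntermediateField.adjoin F {ζ}) := by
  have hcyc : IsCyclotomicExtension {p} F (IntermediateField.adjoin F {ζ}) := by
    have : IsCyclotomicExtension {p} F (IntermediateField.adjoin F {ζ}).toSubalgebra := by
      rw [IntermediateField.adjoin_simple_toSubalgebra_of_isAlgebraic hIntg.isAlgebraic]
      exact hζ.adjoin_isCyclotomicExtension F
    exact this
  exact IsCyclotomicExtension.isGalois {p} F _

open Polynomial in
lemma minpoly_eq_map {F E : Type*} [Field F] [Field E] [Algebra F E] {p : ℕ} [NeZero p]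
    (K : IntermediateField F E) [FiniteDimensional F K]
    (ζ : E) (hζ : IsPrimitiveRoot ζ p) (hIntg : IsIntegral F ζ)
    (hinter : K ⊓ IntermediateField.adjoin F {ζ} = ⊥) :
    minpoly K ζ = (minpoly F ζ).map (algebraMap F K) := by
  have hgal := isGalois_adjoin F ζ hζ hIntg
  have : FiniteDimensional F (IntermediateField.adjoin F {ζ}) :=
    IntermediateField.adjoin.finiteDimensional hIntg
  have hdis : (IntermediateField.adjoin F {ζ}).LinearDisjoint K :=
    IntermediateField.LinearDisjoint.of_inf_eq_bot (by rw [inf_comm]; exact hinter)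
  have hdis' := hdis.symm
  have hli := hdis'.linearIndependent_right
    (IntermediateField.adjoin.powerBasis hIntg).basis.linearIndependent
  have hdeg : (IntermediateField.adjoin.powerBasis hIntg).dim = (minpoly F ζ).natDegree := by
    rw [IntermediateField.adjoin.powerBasis_dim]
  have hintK : IsIntegral K ζ := hIntg.tower_top
  have hdvd : minpoly K ζ ∣ (minpoly F ζ).map (algebraMap F K) :=
    minpoly.dvd_map_of_isScalarTower F K ζ
  have hge : (IntermediateField.adjoin.powerBasis hIntg).dim ≤ (minpoly K ζ).natDegree := by
    by_contra! hlt
    have hz : ∑ i : Fin (IntermediateField.adjoin.powerBasis hIntg).dim,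
        (minpoly K ζ).coeff i • ζ ^ (i : ℕ) = 0 := by
      have h0 := minpoly.aeval K ζ
      rw [aeval_eq_sum_range' hlt] at h0
      rw [← h0, Finset.sum_range]
    have := Fintype.linearIndependent_iff.mp hli (fun i => (minpoly K ζ).coeff i) (by
      rw [← hz]
      refine Finset.sum_congr rfl fun i _ => ?_
      simp) ⟨(minpoly K ζ).natDegree, hlt⟩
    simp only [coeff_natDegree] at this
    rw [(minpoly.monic hintK).leadingCoeff] at this
    exact one_ne_zero this
  refine (eq_of_monic_of_dvd_of_natDegree_le (minpoly.monic hintK)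
    ((minpoly.monic hIntg).map _) hdvd ?_).symm
  rw [natDegree_map, ← hdeg]; exact hge

open Polynomial in
lemma galois_step (p : ℕ) (hp : p.Prime) (K : IntermediateField ℚ ℂ) [FiniteDimensional ℚ K]
    (ζ : ℂ) (hζ : IsPrimitiveRoot ζ p)
    (hinter : K ⊓ IntermediateField.adjoin ℚ {ζ} = ⊥)
    (F : K[X]) (hF : aeval ζ F = 0) (a : ℕ) (ha : a.Coprime p) : aeval (ζ ^ a) F = 0 := by
  have : NeZero p := ⟨hp.ne_zero⟩
  have hIntg : IsIntegral ℚ ζ := hζ.isIntegral hp.pos |>.tower_top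
  have heq := minpoly_eq_map K ζ hζ hIntg hinter
  obtain ⟨G, hG⟩ := minpoly.dvd K ζ hF
  have h0 : aeval (ζ ^ a) (minpoly K ζ) = 0 := by
    rw [heq, aeval_map_algebraMap, ← cyclotomic_eq_minpoly_rat hζ hp.pos,
      cyclotomic_eq_minpoly_rat (hζ.pow_of_coprime a ha) hp.pos, minpoly.aeval]
  rw [hG, map_mul, h0, zero_mul]

lemma cot_poly {p : ℕ} (hp : 0 < p) {z : ℂ} (hz : z ^ p = 1) (hz1 : z ≠ 1) :
    (z + 1) / (1 - z) = (-2 / p) * ∑ j ∈ Finset.range p, (j : ℂ) * z ^ j - 1 := by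
  have hne : (1 - z) ≠ 0 := sub_ne_zero.mpr (Ne.symm hz1)
  have hp' : (p : ℂ) ≠ 0 := by exact_mod_cast hp.ne'
  have key : ∀ n : ℕ, (1 - z) * ∑ j ∈ Finset.range n, (j : ℂ) * z ^ j =
      ∑ j ∈ Finset.range n, z ^ j - 1 - (n - 1) * z ^ n + (if n = 0 then 1 - 1 else 0) := by
    intro n
    induction n with
    | zero => simp
    | succ n ih =>
      rw [Finset.sum_range_succ, Finset.sum_range_succ, mul_add, ih]
      push_cast
      simp
      ring
  have hgeom : ∑ j ∈ Finset.range p, z ^ j = 0 := by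
    have := mul_geom_sum z p
    rw [hz, sub_self, mul_eq_zero] at this
    exact this.resolve_left (sub_ne_zero.mpr hz1)
  have h := key p
  rw [hgeom, hz, if_neg hp.ne'] at h
  have h' : ∑ j ∈ Finset.range p, (j : ℂ) * z ^ j = -p / (1 - z) := by
    rw [eq_div_iff hne]; linear_combination h
  rw [h']
  field_simp
  ring


/-- The values of `i⁻¹`-scaled cotangents written as polynomials in a root of unity. -/
noncomputable def cpol (p : ℕ) (z : ℂ) : ℂ :=
  (-2 / p) * ∑ j ∈ Finset.range p, (j : ℂ) * z ^ j - 1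

lemma sum_zmod_eq_sum_units {p : ℕ} [Fact p.Prime] (G : ZMod p → ℂ) (h0 : G 0 = 0) :
    ∑ j : ZMod p, G j = ∑ u : (ZMod p)ˣ, G u := by
  symm
  refine Finset.sum_bij_ne_zero (fun u _ _ => (u : ZMod p)) (fun _ _ _ => Finset.mem_univ _)
    (fun a _ _ b _ _ h => Units.ext h) ?_ (fun _ _ _ => rfl)
  intro b _ hb
  have : b ≠ 0 := by rintro rfl; exact hb h0
  exact ⟨Units.mk0 b this, Finset.mem_univ _, by simpa using hb, rfl⟩

lemma LFunction_one_odd {p : ℕ} [Fact p.Prime] (χ : DirichletCharacter ℂ p) (hχ : χ.Odd) :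
    DirichletCharacter.LFunction χ 1 = (π / (2 * p * Complex.I)) *
      ∑ u : (ZMod p)ˣ, χ u *
        cpol p (Complex.exp (2 * π * Complex.I / p) ^ (u : ZMod p).val) := by
  have hp : p.Prime := Fact.out
  have hp0 : (p : ℂ) ≠ 0 := by exact_mod_cast hp.ne_zero
  rw [DirichletCharacter.LFunction, ZMod.LFunction_def_odd hχ.to_fun,
    sum_zmod_eq_sum_units _ (by rw [hχ.to_fun.map_zero, zero_mul]), Complex.cpow_neg_one,
    Finset.mul_sum, Finset.mul_sum]
  refine Finset.sum_congr rfl fun u _ => ?_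
  have hv0 : 0 < (u : ZMod p).val := by
    rw [Nat.pos_iff_ne_zero, Ne, ZMod.val_eq_zero]; exact u.ne_zero
  have hv1 : (u : ZMod p).val < p := ZMod.val_lt _
  have hpR : (0 : ℝ) < p := by exact_mod_cast hp.pos
  have hprim := Complex.isPrimitiveRoot_exp p hp.ne_zero
  set ζ := Complex.exp (2 * π * Complex.I / p) with hζ
  have hne1 : ζ ^ (u : ZMod p).val ≠ 1 := hprim.pow_ne_one_of_pos_of_lt hv0.ne' hv1
  have hzp : (ζ ^ (u : ZMod p).val) ^ p = 1 := by
    rw [← pow_mul, mul_comm, pow_mul, hprim.pow_eq_one, one_pow]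
  rw [ZMod.toAddCircle_apply, hurwitzOdd_one (by positivity)
    (by rw [div_lt_one hpR]; exact_mod_cast hv1), Complex.cot_eq_exp_ratio, cpol,
    ← cot_poly hp.pos hzp hne1]
  have e : Complex.exp (2 * Complex.I * (π * (((u : ZMod p).val / p : ℝ) : ℂ))) =
      ζ ^ (u : ZMod p).val := by
    rw [hζ, ← Complex.exp_nat_mul]
    congr 1
    push_cast
    ring
  rw [e]
  have h1 : 1 - ζ ^ (u : ZMod p).val ≠ 0 := sub_ne_zero.mpr (Ne.symm hne1)
  have hI := Complex.I_ne_zero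
  field_simp

/-- Multiplicative Fourier coefficients. -/
noncomputable def hatF {p : ℕ} [Fact p.Prime] (F : ZMod p → ℂ) (χ : DirichletCharacter ℂ p) : ℂ :=
  ∑ u : (ZMod p)ˣ, χ ((u⁻¹ : (ZMod p)ˣ) : ZMod p) * F u

lemma hat_inversion {p : ℕ} [Fact p.Prime] (F : ZMod p → ℂ) (h0 : F 0 = 0) (b : ZMod p) :
    ∑ χ : DirichletCharacter ℂ p, hatF F χ * χ b = p.totient * F b := by
  have hp : p.Prime := Fact.out
  simp only [hatF, Finset.sum_mul]
  rw [Finset.sum_comm]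
  have : ∀ u : (ZMod p)ˣ, ∑ χ : DirichletCharacter ℂ p,
      χ ((u⁻¹ : (ZMod p)ˣ) : ZMod p) * F u * χ b =
      F u * (if (u : ZMod p) = b then (p.totient : ℂ) else 0) := by
    intro u
    rw [← DirichletCharacter.sum_char_inv_mul_char_eq ℂ u.isUnit b, Finset.mul_sum]
    refine Finset.sum_congr rfl fun χ _ => ?_
    rw [ZMod.inv_coe_unit]
    ring
  simp_rw [this]
  rw [← sum_zmod_eq_sum_units (fun r => F r * (if r = b then (p.totient : ℂ) else 0))
    (by simp [h0])]
  simp [mul_comm]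

lemma hat_even {p : ℕ} [Fact p.Prime] (F : ZMod p → ℂ) (hodd : ∀ r, F (-r) = -F r)
    (χ : DirichletCharacter ℂ p) (hχ : χ.Even) : hatF F χ = 0 := by
  have h : hatF F χ = - hatF F χ := by
    conv_lhs => rw [hatF, ← Equiv.sum_comp (Equiv.neg _)]
    rw [hatF, ← Finset.sum_neg_distrib]
    refine Finset.sum_congr rfl fun u _ => ?_
    simp only [Equiv.neg_apply, inv_neg, Units.val_neg, hodd, hχ.eval_neg]
    ring
  linear_combination h / 2

lemma main_one {p k : ℕ} [Fact p.Prime] (hk : 0 < k) (F : ZMod p → ℂ)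
    (hodd : ∀ r, F (-r) = -F r) (g : ℂ → ℂ) (hg : Differentiable ℂ g)
    (hagree : ∀ s : ℂ, 1 < s.re →
      g s = ∑' n : ℕ, (dk k (n + 1) : ℂ) * F ((n + 1 : ℕ) : ZMod p) / ((n : ℂ) + 1) ^ s)
    (hval : g 1 = 0) :
    ∑ m : Fin k → (ZMod p)ˣ, F ((∏ i, m i : (ZMod p)ˣ) : ZMod p) *
      ∏ i, cpol p (Complex.exp (2 * π * Complex.I / p) ^ (m i : ZMod p).val) = 0 := by
  have hp : p.Prime := Fact.out
  have h0 : F 0 = 0 := by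
    have := hodd 0
    rw [neg_zero] at this
    linear_combination this / 2
  have htot : (p.totient : ℂ) ≠ 0 := by
    exact_mod_cast (Nat.totient_pos.mpr hp.pos).ne'
  set R : ℂ → ℂ := fun s => ∑ χ : DirichletCharacter ℂ p,
    hatF F χ * DirichletCharacter.LFunction χ s ^ k with hR
  have hRd : Continuous R := by
    refine continuous_finsetSum _ fun χ _ => ?_
    rcases χ.even_or_odd with h | h
    · simp only [hat_even F hodd χ h, zero_mul]; exact continuous_const
    · have hne : χ ≠ 1 := by
        rintro rfl
        have : (1 : DirichletCharacter ℂ p).Even := by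
          rw [DirichletCharacter.Even, MulChar.one_apply (by simp)]
        exact DirichletCharacter.Even.not_odd _ this h
      exact continuous_const.mul ((DirichletCharacter.differentiable_LFunction hne).continuous.pow k)
  have hRg : ∀ s : ℂ, 1 < s.re → R s = p.totient * g s := by
    intro s hs
    have hsum : HasSum (LSeries.term (fun n => (dk k n : ℂ) * (p.totient * F (n : ZMod p))) s) (R s) := by
      have h1 : HasSum (fun n => ∑ χ : DirichletCharacter ℂ p,
          hatF F χ * LSeries.term (fun n => (dk k n : ℂ) * χ n) s n) (R s) := by
        refine hasSum_sum fun χ _ => ?_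
        rw [DirichletCharacter.LFunction_eq_LSeries χ hs]
        exact (LSeries_dk χ hs k).mul_left _
      refine h1.congr_fun fun n => ?_
      rcases eq_or_ne n 0 with rfl | hn
      · simp
      · simp only [LSeries.term_of_ne_zero hn]
        rw [← hat_inversion F h0, Finset.mul_sum, Finset.sum_div]
        refine Finset.sum_congr rfl fun χ _ => ?_
        ring
    rw [hagree s hs, ← hsum.tsum_eq, hsum.summable.tsum_eq_zero_add, LSeries.term_zero, zero_add,
      ← tsum_mul_left]
    refine tsum_congr fun n => ?_
    rw [LSeries.term_of_ne_zero (Nat.succ_ne_zero n)]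
    push_cast
    ring
  have hR1 : R 1 = 0 := by
    have t1 : Tendsto (fun s : ℝ => R s) (𝓝[>] 1) (𝓝 (R 1)) := by
      have := ((hRd.comp Complex.continuous_ofReal).tendsto 1).mono_left
        (nhdsWithin_le_nhds (s := Set.Ioi (1:ℝ)))
      simpa [Function.comp_def] using this
    have t2 : Tendsto (fun s : ℝ => (p.totient : ℂ) * g s) (𝓝[>] 1) (𝓝 (p.totient * g 1)) := by
      have := ((continuous_const.mul hg.continuous : Continuous fun s => (p.totient : ℂ) * g s).comp
        Complex.continuous_ofReal |>.tendsto 1).mono_left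
        (nhdsWithin_le_nhds (s := Set.Ioi (1:ℝ)))
      simpa [Function.comp_def] using this
    have := tendsto_nhds_unique t1 (t2.congr' (by
      filter_upwards [self_mem_nhdsWithin] with s hs
      exact (hRg s (by simpa using hs)).symm))
    rw [this, hval, mul_zero]
  set c : (ZMod p)ˣ → ℂ := fun u =>
    cpol p (Complex.exp (2 * π * Complex.I / p) ^ (u : ZMod p).val) with hc
  set A : ℂ := π / (2 * p * Complex.I) with hA
  have hA0 : A ≠ 0 := by
    have : (p : ℂ) ≠ 0 := by exact_mod_cast hp.ne_zero
    have h2 : (π : ℂ) ≠ 0 := by exact_mod_cast Real.pi_ne_zero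
    rw [hA]
    exact div_ne_zero h2 (mul_ne_zero (mul_ne_zero two_ne_zero this) Complex.I_ne_zero)
  have hterm : ∀ χ : DirichletCharacter ℂ p, hatF F χ * DirichletCharacter.LFunction χ 1 ^ k =
      A ^ k * (hatF F χ * (∑ u : (ZMod p)ˣ, χ u * c u) ^ k) := by
    intro χ
    rcases χ.even_or_odd with h | h
    · simp [hat_even F hodd χ h]
    · have e : DirichletCharacter.LFunction χ 1 = A * ∑ u : (ZMod p)ˣ, χ u * c u :=
        LFunction_one_odd χ h
      rw [e, mul_pow]
      ring
  have hS : ∑ χ : DirichletCharacter ℂ p, hatF F χ * (∑ u : (ZMod p)ˣ, χ u * c u) ^ k = 0 := by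
    have : R 1 = A ^ k * ∑ χ : DirichletCharacter ℂ p,
        hatF F χ * (∑ u : (ZMod p)ˣ, χ u * c u) ^ k := by
      rw [Finset.mul_sum]
      exact Finset.sum_congr rfl fun χ _ => hterm χ
    rw [hR1] at this
    exact (mul_eq_zero.mp this.symm).resolve_left (pow_ne_zero _ hA0)
  have hexp : ∀ χ : DirichletCharacter ℂ p, hatF F χ * (∑ u : (ZMod p)ˣ, χ u * c u) ^ k =
      ∑ m : Fin k → (ZMod p)ˣ,
        (hatF F χ * χ ((∏ i, m i : (ZMod p)ˣ) : ZMod p)) * ∏ i, c (m i) := by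
    intro χ
    rw [Fintype.sum_pow, Finset.mul_sum]
    refine Finset.sum_congr rfl fun m _ => ?_
    rw [Finset.prod_mul_distrib, Units.coe_prod, map_prod]
    ring
  simp_rw [hexp] at hS
  rw [Finset.sum_comm] at hS
  simp_rw [← Finset.sum_mul, hat_inversion F h0, mul_assoc] at hS
  rw [← Finset.mul_sum] at hS
  exact (mul_eq_zero.mp hS).resolve_left htot

open Polynomial in
lemma main_two {p k : ℕ} [Fact p.Prime] (K : IntermediateField ℚ ℂ) [FiniteDimensional ℚ K]
    (ζ : ℂ) (hζ : IsPrimitiveRoot ζ p)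
    (hinter : K ⊓ IntermediateField.adjoin ℚ {ζ} = ⊥)
    (F : ZMod p → ℂ) (hFK : ∀ r, F r ∈ K)
    (h : ∑ m : Fin k → (ZMod p)ˣ, F ((∏ i, m i : (ZMod p)ˣ) : ZMod p) *
      ∏ i, cpol p (ζ ^ (m i : ZMod p).val) = 0) (a : (ZMod p)ˣ) :
    ∑ m : Fin k → (ZMod p)ˣ, F ((∏ i, m i : (ZMod p)ˣ) : ZMod p) *
      ∏ i, cpol p (ζ ^ ((a * m i : (ZMod p)ˣ) : ZMod p).val) = 0 := by
  have hp : p.Prime := Fact.out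
  set G : K[X] := ∑ m : Fin k → (ZMod p)ˣ, C (⟨F ((∏ i, m i : (ZMod p)ˣ) : ZMod p), hFK _⟩ : K) *
    ∏ i, (C (-2 / (p : K)) * ∑ j ∈ Finset.range p, C (j : K) * (X ^ (m i : ZMod p).val) ^ j - 1) with hG
  have hev : ∀ z : ℂ, aeval z G = ∑ m : Fin k → (ZMod p)ˣ, F ((∏ i, m i : (ZMod p)ˣ) : ZMod p) *
      ∏ i, cpol p (z ^ (m i : ZMod p).val) := by
    intro z
    simp only [hG, cpol, map_sum, map_mul, map_prod, map_sub, map_one, aeval_C, map_pow, aeval_X]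
    refine Finset.sum_congr rfl fun m _ => ?_
    simp
    left
    rfl
  have h1 := galois_step p hp K ζ hζ hinter G (by rw [hev]; exact h) (a : ZMod p).val
    (ZMod.val_coe_unit_coprime a)
  rw [hev] at h1
  rw [← h1]
  refine Finset.sum_congr rfl fun m _ => ?_
  congr 1
  refine Finset.prod_congr rfl fun i _ => ?_
  congr 1
  rw [← pow_mul, Units.val_mul, ZMod.val_mul, ← pow_eq_pow_mod _ hζ.pow_eq_one]

lemma main_three {p k : ℕ} [Fact p.Prime] (hk : 0 < k)
    (hgcd : Nat.gcd k (p - 1) = 1 ∨ (Nat.gcd k (p - 1) = 2 ∧ p % 4 = 3))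
    (F : ZMod p → ℂ) (hodd : ∀ r, F (-r) = -F r) (c : (ZMod p)ˣ → ℂ)
    (hc : ∀ χ : DirichletCharacter ℂ p, χ.Odd → ∑ u : (ZMod p)ˣ, χ u * c u ≠ 0)
    (h : ∀ a : (ZMod p)ˣ, ∑ m : Fin k → (ZMod p)ˣ, F ((∏ i, m i : (ZMod p)ˣ) : ZMod p) *
      ∏ i, c (a * m i) = 0) (r : ZMod p) : F r = 0 := by
  have hp : p.Prime := Fact.out
  have h0 : F 0 = 0 := by
    have := hodd 0
    rw [neg_zero] at this
    linear_combination this / 2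
  have htot : (p.totient : ℂ) ≠ 0 := by
    exact_mod_cast (Nat.totient_pos.mpr hp.pos).ne'
  have h1 : ∀ a : (ZMod p)ˣ, ∑ m : Fin k → (ZMod p)ˣ,
      F ((a ^ k * ∏ i, m i : (ZMod p)ˣ) : ZMod p) * ∏ i, c (m i) = 0 := by
    intro a
    rw [← h a⁻¹, ← Equiv.sum_comp (Equiv.mulLeft (fun _ : Fin k => a⁻¹))]
    refine Finset.sum_congr rfl fun m _ => ?_
    simp [Finset.prod_mul_distrib]
  have h2 : ∀ b : (ZMod p)ˣ, ∑ m : Fin k → (ZMod p)ˣ,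
      F ((b * ∏ i, m i : (ZMod p)ˣ) : ZMod p) * ∏ i, c (m i) = 0 := by
    intro b
    obtain ⟨a, ha | ha⟩ := exists_kth_pow p k hp hgcd b
    · rw [← ha]; exact h1 a
    · have h3 := h1 a
      rw [ha] at h3
      rw [← neg_eq_zero, ← h3, ← Finset.sum_neg_distrib]
      refine Finset.sum_congr rfl fun m _ => ?_
      rw [neg_mul, Units.val_neg, hodd, neg_mul]
  have h3 : ∀ χ : DirichletCharacter ℂ p, hatF F χ = 0 := by
    intro χ
    rcases χ.even_or_odd with he | ho
    · exact hat_even F hodd χ he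
    · have hprod : hatF F χ * (∑ u : (ZMod p)ˣ, χ u * c u) ^ k = 0 := by
        have e : ∑ b : (ZMod p)ˣ, χ ((b⁻¹ : (ZMod p)ˣ) : ZMod p) * ∑ m : Fin k → (ZMod p)ˣ,
            F ((b * ∏ i, m i : (ZMod p)ˣ) : ZMod p) * ∏ i, c (m i) = 0 := by
          exact Finset.sum_eq_zero fun b _ => by rw [h2, mul_zero]
        rw [← e, Fintype.sum_pow, Finset.mul_sum]
        simp_rw [Finset.mul_sum]
        rw [Finset.sum_comm]
        refine Finset.sum_congr rfl fun m _ => ?_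
        rw [Finset.prod_mul_distrib, ← map_prod, ← Units.coe_prod, hatF, Finset.sum_mul,
          ← Equiv.sum_comp (Equiv.mulRight (∏ i, m i))]
        refine Finset.sum_congr rfl fun b _ => ?_
        have : χ ((b⁻¹ : (ZMod p)ˣ) : ZMod p) =
            χ (((b * ∏ i, m i)⁻¹ : (ZMod p)ˣ) : ZMod p) * χ ((∏ i, m i : (ZMod p)ˣ) : ZMod p) := by
          rw [← map_mul, ← Units.val_mul]
          congr 2
          rw [mul_inv, inv_mul_cancel_right]
        rw [this, Equiv.coe_mulRight]
        ring
      exact (mul_eq_zero.mp hprod).resolve_right (pow_ne_zero _ (hc χ ho))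
  have h4 := hat_inversion F h0 r
  simp only [h3, zero_mul, Finset.sum_const_zero] at h4
  exact (mul_eq_zero.mp h4.symm).resolve_left htot

theorem stmt18 (p k : ℕ) (hp : p.Prime) (hodd : Odd p) (hk : 0 < k)
    (hgcd : Nat.gcd k (p - 1) = 1 ∨ (Nat.gcd k (p - 1) = 2 ∧ p % 4 = 3))
    (K : IntermediateField ℚ ℂ) [FiniteDimensional ℚ K]
    (hinter : K ⊓ IntermediateField.adjoin ℚ {Complex.exp (2 * π * Complex.I / p)} = ⊥)
    (f : ℤ → ℂ) (hfK : ∀ n : ℤ, f n ∈ K)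
    (hoddf : ∀ n : ℤ, f (-n) = -f n) (hper : ∀ n : ℤ, f (n + p) = f n)
    (g : ℂ → ℂ) (hg : Differentiable ℂ g)
    (hagree : ∀ s : ℂ, 1 < s.re →
      g s = ∑' n : ℕ, (dk k (n + 1) : ℂ) * f (n + 1) / ((n : ℂ) + 1) ^ s)
    (hval : g 1 = 0) :
    ∀ n : ℤ, f n = 0 := by
  have hfact : Fact p.Prime := ⟨hp⟩
  set F : ZMod p → ℂ := fun r => f (r.val : ℤ) with hF
  have hfF : ∀ n : ℤ, F (n : ZMod p) = f n := by
    intro n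
    simp only [hF]
    rw [ZMod.val_intCast]
    have hp' : Function.Periodic f (p : ℤ) := hper
    rw [Int.emod_def, mul_comm]
    exact hp'.sub_int_mul_eq (n / p)
  have hFodd : ∀ r, F (-r) = -F r := by
    intro r
    obtain ⟨n, rfl⟩ := ZMod.intCast_surjective r
    rw [← Int.cast_neg, hfF, hfF, hoddf]
  have hFK : ∀ r, F r ∈ K := fun r => hfK _
  have hprim := Complex.isPrimitiveRoot_exp p hp.ne_zero
  have m1 := main_one hk F hFodd g hg (by
    intro s hs
    rw [hagree s hs]
    refine tsum_congr fun n => ?_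
    rw [← hfF]
    push_cast
    rfl) hval
  have m2 := main_two K _ hprim hinter F hFK m1
  have m3 := main_three hk hgcd F hFodd
    (fun u => cpol p (Complex.exp (2 * π * Complex.I / p) ^ (u : ZMod p).val)) (by
      intro χ hχ h0
      have h1 := LFunction_one_odd χ hχ
      rw [h0, mul_zero] at h1
      refine DirichletCharacter.LFunction_apply_one_ne_zero ?_ h1
      rintro rfl
      have : (1 : DirichletCharacter ℂ p).Even := by
        rw [DirichletCharacter.Even, MulChar.one_apply (by simp)]
      exact DirichletCharacter.Even.not_odd _ this hχ) m2
  intro n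
  rw [← hfF]
  exact m3 _
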